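/- arXiv:2605.07601 — 2 statements merged into one kernel-verified Lean document; each statement's English description precedes it below -/
import Mathlib

section
/- Let Ω ⊆ ℂ be open, let μ, 𝒜, ℬ, ℱ : Ω → ℂ, and let w : Ω → ℂ be real-differentiable on Ω and satisfy the Beltrami–Vekua equation with data (μ, 𝒜, ℬ, ℱ) on Ω. Let φ : Ω → ℂ be real-differentiable and nowhere zero on Ω. Then the function w̃ := φ·w is real-differentiable on Ω and satisfies the Beltrami–Vekua equation with data (μ', 𝒜', ℬ', ℱ'), where μ' = μ, 𝒜' = 𝒜 − φ_z̄/φ + μ·φ_z/φ, ℬ' = ℬ·φ/conj(φ), and ℱ' = φ·ℱ. -/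
open ComplexConjugate

/-- Wirtinger derivative ∂/∂z of a real-differentiable function ℂ → ℂ. -/
noncomputable def wz (f : ℂ → ℂ) (z : ℂ) : ℂ :=
  ((fderiv ℝ f z) 1 - Complex.I * (fderiv ℝ f z) Complex.I) / 2

/-- Wirtinger derivative ∂/∂z̄ of a real-differentiable function ℂ → ℂ. -/
noncomputable def wzbar (f : ℂ → ℂ) (z : ℂ) : ℂ :=
  ((fderiv ℝ f z) 1 + Complex.I * (fderiv ℝ f z) Complex.I) / 2

/-- Leibniz rule for the Wirtinger derivative ∂/∂z. -/
theorem wz_mul {f g : ℂ → ℂ} {z : ℂ} (hf : DifferentiableAt ℝ f z)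
    (hg : DifferentiableAt ℝ g z) :
    wz (fun ζ => f ζ * g ζ) z = wz f z * g z + f z * wz g z := by
  simp only [wz, fderiv_fun_mul hf hg, add_apply,
    smul_apply, smul_eq_mul]
  ring

/-- Leibniz rule for the Wirtinger derivative ∂/∂z̄. -/
theorem wzbar_mul {f g : ℂ → ℂ} {z : ℂ} (hf : DifferentiableAt ℝ f z)
    (hg : DifferentiableAt ℝ g z) :
    wzbar (fun ζ => f ζ * g ζ) z = wzbar f z * g z + f z * wzbar g z := by
  simp only [wzbar, fderiv_fun_mul hf hg, add_apply,
    smul_apply, smul_eq_mul]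
  ring

/-- Gauge transformation of a Beltrami–Vekua equation.
If `w` is real-differentiable and satisfies the BV equation with data (μ, 𝒜, ℬ, ℱ) on the
open set Ω, and φ is real-differentiable and nowhere zero on Ω, then `φ·w` is
real-differentiable on Ω and satisfies the BV equation with data
(μ, 𝒜 − φ_z̄/φ + μ·φ_z/φ, ℬ·φ/conj φ, φ·ℱ). -/
theorem gauge_transform_BV (Ω : Set ℂ) (hΩ : IsOpen Ω)
    (μ 𝒜 ℬ ℱ w φ : ℂ → ℂ)
    (hw : ∀ z ∈ Ω, DifferentiableAt ℝ w z)
    (hBV : ∀ z ∈ Ω,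
      wzbar w z - μ z * wz w z + 𝒜 z * w z + ℬ z * conj (w z) = ℱ z)
    (hφ : ∀ z ∈ Ω, DifferentiableAt ℝ φ z)
    (hφ0 : ∀ z ∈ Ω, φ z ≠ 0) :
    (∀ z ∈ Ω, DifferentiableAt ℝ (fun ζ => φ ζ * w ζ) z) ∧
    (∀ z ∈ Ω,
      wzbar (fun ζ => φ ζ * w ζ) z
        - μ z * wz (fun ζ => φ ζ * w ζ) z
        + (𝒜 z - wzbar φ z / φ z + μ z * wz φ z / φ z) * (φ z * w z)
        + (ℬ z * φ z / conj (φ z)) * conj (φ z * w z)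
        = φ z * ℱ z) := by
  refine ⟨fun z hz => (hφ z hz).mul (hw z hz), fun z hz => ?_⟩
  have h0 := hφ0 z hz
  have h0' : conj (φ z) ≠ 0 := (map_ne_zero _).2 h0
  rw [wz_mul (hφ z hz) (hw z hz), wzbar_mul (hφ z hz) (hw z hz), ← hBV z hz, map_mul]
  field_simp
  ring
end

section
/- Let Ω₁, Ω₂ ⊆ ℂ be open, let Φ : Ω₂ → Ω₁ and Ψ : Ω₁ → Ω₂ be real-differentiable with Φ(Ψ(ζ)) = ζ for all ζ ∈ Ω₁, and let μ : Ω₂ → ℂ satisfy the Beltrami equation Φ_z̄(w) = μ(w)·Φ_z(w) for all w ∈ Ω₂, with Φ_z(Ψ(ζ)) ≠ 0 for all ζ ∈ Ω₁. Then the conjugate Beltrami identity holds: Ψ_ζ̄(ζ) = −μ(Ψ(ζ))·conj(Ψ_ζ(ζ)) for all ζ ∈ Ω₁. -/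
open ComplexConjugate

/-- The real derivative of a function `ℂ → ℂ` in terms of its Wirtinger derivatives. -/
theorem fderiv_eq_wz_mul_add_wzbar_mul_conj (f : ℂ → ℂ) (z h : ℂ) :
    fderiv ℝ f z h = wz f z * h + wzbar f z * conj h := by
  have hh : h = h.re • (1 : ℂ) + h.im • Complex.I := by
    simp [Complex.re_add_im]
  have hc : conj h = (h.re : ℂ) - h.im * Complex.I := by
    apply Complex.ext <;> simp
  have hlin : fderiv ℝ f z h =
      (h.re : ℂ) * fderiv ℝ f z 1 + (h.im : ℂ) * fderiv ℝ f z Complex.I := by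
    conv_lhs => rw [hh]
    rw [map_add, map_smul, map_smul, Complex.real_smul, Complex.real_smul]
  rw [hlin, hc, wz, wzbar]
  nth_rewrite 3 [← Complex.re_add_im h]
  linear_combination ((h.im : ℂ) * fderiv ℝ f z Complex.I) * Complex.I_sq

/-- The Wirtinger chain rule for `∂/∂z̄`. -/
theorem wzbar_comp {f g : ℂ → ℂ} {z : ℂ} (hf : DifferentiableAt ℝ f (g z))
    (hg : DifferentiableAt ℝ g z) :
    wzbar (f ∘ g) z = wz f (g z) * wzbar g z + wzbar f (g z) * conj (wz g z) := by
  conv_lhs => rw [wzbar, fderiv_comp z hf hg]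
  simp only [ContinuousLinearMap.comp_apply, fderiv_eq_wz_mul_add_wzbar_mul_conj f (g z),
    fderiv_eq_wz_mul_add_wzbar_mul_conj g z, map_add, map_mul, map_one, map_neg, Complex.conj_I]
  linear_combination
    (wz f (g z) * (wz g z - wzbar g z) + wzbar f (g z) * (conj (wzbar g z) - conj (wz g z))) / 2
      * Complex.I_sq

/-- The identity is holomorphic: a function equal to it near `z` has vanishing `∂/∂z̄`. -/
theorem wzbar_eq_zero_of_eventuallyEq_id {f : ℂ → ℂ} {z : ℂ} (h : f =ᶠ[nhds z] id) :
    wzbar f z = 0 := by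
  simp [wzbar, h.fderiv_eq]

/-- The conjugate Beltrami identity. If Φ : Ω₂ → Ω₁ solves the Beltrami
equation Φ_z̄ = μ·Φ_z on Ω₂ and Ψ : Ω₁ → Ω₂ is a right inverse (Φ∘Ψ = id on Ω₁) with
Φ_z(Ψ(ζ)) ≠ 0, then Ψ_ζ̄ = −(μ∘Ψ)·conj(Ψ_ζ) on Ω₁. -/
theorem conjugate_beltrami_identity (Ω₁ Ω₂ : Set ℂ)
    (hΩ₁ : IsOpen Ω₁) (hΩ₂ : IsOpen Ω₂)
    (Φ Ψ μ : ℂ → ℂ)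
    (hΨmap : ∀ ζ ∈ Ω₁, Ψ ζ ∈ Ω₂)
    (hΦmap : ∀ w ∈ Ω₂, Φ w ∈ Ω₁)
    (hΦdiff : ∀ w ∈ Ω₂, DifferentiableAt ℝ Φ w)
    (hΨdiff : ∀ ζ ∈ Ω₁, DifferentiableAt ℝ Ψ ζ)
    (hinv : ∀ ζ ∈ Ω₁, Φ (Ψ ζ) = ζ)
    (hBel : ∀ w ∈ Ω₂, wzbar Φ w = μ w * wz Φ w)
    (hΦz : ∀ ζ ∈ Ω₁, wz Φ (Ψ ζ) ≠ 0) :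
    ∀ ζ ∈ Ω₁, wzbar Ψ ζ = -(μ (Ψ ζ)) * conj (wz Ψ ζ) := by
  intro ζ hζ
  have hid : Φ ∘ Ψ =ᶠ[nhds ζ] id :=
    Filter.eventuallyEq_of_mem (hΩ₁.mem_nhds hζ) hinv
  have hchain := wzbar_comp (hΦdiff _ (hΨmap ζ hζ)) (hΨdiff ζ hζ)
  rw [wzbar_eq_zero_of_eventuallyEq_id hid, hBel _ (hΨmap ζ hζ)] at hchain
  apply mul_left_cancel₀ (hΦz ζ hζ)
  linear_combination -hchain
end
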